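/- arXiv:1410.3004 — 2 statements merged into one kernel-verified Lean document; each statement's English description precedes it below -/
import Mathlib

section
/- Let ε ≠ 0 and let x : ℝ → ℝ and y : ℝ → (Fin n → ℝ) be differentiable and satisfy the undamped, noise-free triad system ẋ(t) = (1/ε) ∑_{j,k} a j k · y_j(t) y_k(t) and ẏ_j(t) = (1/ε) ∑_k c j k · x(t) y_k(t) + (1/ε²) ∑_{i,k} B j i k · y_i(t) y_k(t). Then the total energy t ↦ x(t)² + ∑_j y_j(t)² is constant in t. -/
/-- A quadratic form whose coefficients are antisymmetric vanishes. -/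
theorem sum_sum_mul_mul_eq_zero_of_antisymm {ι : Type*} [Fintype ι] (m : ι → ι → ℝ)
    (hm : ∀ j k, m j k + m k j = 0) (v : ι → ℝ) :
    ∑ j, ∑ k, m j k * v j * v k = 0 := by
  have hswap : ∑ j, ∑ k, m j k * v j * v k = ∑ j, ∑ k, m k j * v k * v j :=
    Finset.sum_comm
  have hsum : ∑ j, ∑ k, m j k * v j * v k + ∑ j, ∑ k, m k j * v k * v j = 0 := by
    simp only [← Finset.sum_add_distrib]
    refine Finset.sum_eq_zero fun j _ => Finset.sum_eq_zero fun k _ => ?_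
    linear_combination v j * v k * hm j k
  linarith

/-- A cubic form whose coefficients have vanishing cyclic sums vanishes. -/
theorem sum_sum_sum_mul_eq_zero_of_cyclic {ι : Type*} [Fintype ι] (B : ι → ι → ι → ℝ)
    (hB : ∀ i j k, B j i k + B i k j + B k j i = 0) (v : ι → ℝ) :
    ∑ j, ∑ i, ∑ k, B j i k * v j * v i * v k = 0 := by
  have rotate (f : ι → ι → ι → ℝ) :
      ∑ j, ∑ i, ∑ k, f j i k = ∑ j, ∑ i, ∑ k, f i k j := by
    calc ∑ j, ∑ i, ∑ k, f j i k = ∑ j, ∑ k, ∑ i, f j i k :=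
          Finset.sum_congr rfl fun j _ => Finset.sum_comm
      _ = ∑ k, ∑ j, ∑ i, f j i k := Finset.sum_comm
  have h₁ := rotate fun j i k => B j i k * v j * v i * v k
  have h₂ := rotate fun j i k => B i k j * v i * v k * v j
  have hsum : ∑ j, ∑ i, ∑ k, B j i k * v j * v i * v k
      + ∑ j, ∑ i, ∑ k, B i k j * v i * v k * v j
      + ∑ j, ∑ i, ∑ k, B k j i * v k * v j * v i = 0 := by
    simp only [← Finset.sum_add_distrib]
    refine Finset.sum_eq_zero fun j _ => Finset.sum_eq_zero fun i _ =>
      Finset.sum_eq_zero fun k _ => ?_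
    linear_combination v j * v i * v k * hB i j k
  linarith

/-- For the undamped, noise-free triad system with
energy-conserving interaction coefficients, the total energy
`t ↦ x(t)² + ∑_j y_j(t)²` is constant. -/
theorem triad_total_energy_conserved
    (n : ℕ) (hn : 1 ≤ n)
    (a c : Fin n → Fin n → ℝ)
    (hac : ∀ j k, a j k + a k j + c j k + c k j = 0)
    (B : Fin n → Fin n → Fin n → ℝ)
    (hB : ∀ i j k, B j i k + B i k j + B k j i = 0)
    (ε : ℝ) (hε : ε ≠ 0)
    (x : ℝ → ℝ) (y : ℝ → Fin n → ℝ)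
    (hx : ∀ t, HasDerivAt x ((1 / ε) * ∑ j, ∑ k, a j k * y t j * y t k) t)
    (hy : ∀ t j, HasDerivAt (fun s => y s j)
      ((1 / ε) * ∑ k, c j k * x t * y t k
        + (1 / ε ^ 2) * ∑ i, ∑ k, B j i k * y t i * y t k) t) :
    ∀ s t : ℝ, x s ^ 2 + ∑ j, (y s j) ^ 2 = x t ^ 2 + ∑ j, (y t j) ^ 2 := by
  have hderiv (t : ℝ) : HasDerivAt (fun s => x s ^ 2 + ∑ j, (y s j) ^ 2) 0 t := by
    have hquad := sum_sum_mul_mul_eq_zero_of_antisymm (fun j k => a j k + c j k)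
      (fun j k => by linear_combination hac j k) (y t)
    have hcubic := sum_sum_sum_mul_eq_zero_of_cyclic B hB (y t)
    have hsum := ((hx t).pow 2).add
      (HasDerivAt.fun_sum (u := Finset.univ) fun j _ => (hy t j).pow 2)
    refine hsum.congr_deriv ?_
    have hslow : ∑ j, y t j * ∑ k, c j k * x t * y t k
        = x t * ∑ j, ∑ k, c j k * y t j * y t k := by
      simp only [Finset.mul_sum]
      exact Finset.sum_congr rfl fun j _ => Finset.sum_congr rfl fun k _ => by ring
    have hfast : ∑ j, y t j * ∑ i, ∑ k, B j i k * y t i * y t k = 0 := by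
      rw [← hcubic]
      simp only [Finset.mul_sum]
      exact Finset.sum_congr rfl fun j _ => Finset.sum_congr rfl fun i _ =>
        Finset.sum_congr rfl fun k _ => by ring
    have hsplit : ∑ j, (2 : ℕ) * y t j ^ (2 - 1) * ((1 / ε) * ∑ k, c j k * x t * y t k
          + (1 / ε ^ 2) * ∑ i, ∑ k, B j i k * y t i * y t k)
        = 2 * (1 / ε) * ∑ j, y t j * ∑ k, c j k * x t * y t k
          + 2 * (1 / ε ^ 2) * ∑ j, y t j * ∑ i, ∑ k, B j i k * y t i * y t k := by
      rw [Finset.mul_sum, Finset.mul_sum, ← Finset.sum_add_distrib]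
      refine Finset.sum_congr rfl fun j _ => ?_
      push_cast
      ring
    rw [hsplit, hslow, hfast]
    simp only [add_mul, Finset.sum_add_distrib] at hquad
    push_cast
    linear_combination 2 * (1 / ε) * x t * hquad
  exact is_const_of_deriv_eq_zero (fun t => (hderiv t).differentiableAt)
    fun t => (hderiv t).deriv
end

section
/- Let γ, σ > 0, ε ≠ 0, and define ρ : ℝ × (Fin n → ℝ) → ℝ by ρ(x, y) = (√(2γ)/(√(2π) σ))^{n+1} exp( −(γ/σ²)(x² + ∑_j y_j²) ). Then ρ is a stationary solution of the Fokker–Planck equation of the full triad model: for all (x, y), γ ∂_x(x ρ) + (σ²/2) ∂_{xx} ρ − (1/ε)[ ∑_{j,k} a j k · y_j y_k · ∂_x ρ + x ∑_{j,k} c j k · ∂_{y_j}(y_k ρ) ] − (1/ε²) ∑_{i,j,k} B j i k · ∂_{y_j}(y_i y_k ρ) = 0. In particular, the stationary distribution of (x, y₁, …, y_n) is a product of Gaussians N(0, σ²/(2γ)) and does not depend on ε. -/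
open Finset in
/-- A quadratic form whose coefficients are antisymmetric vanishes. -/
theorem sum_mul_mul_eq_zero_of_antisymm {ι : Type*} [Fintype ι] (m : ι → ι → ℝ)
    (hm : ∀ j k, m j k + m k j = 0) (y : ι → ℝ) :
    ∑ j, ∑ k, m j k * y j * y k = 0 := by
  have hswap : ∑ j, ∑ k, m j k * y j * y k = ∑ j, ∑ k, m k j * y k * y j := sum_comm
  have hsum : ∑ j, ∑ k, m j k * y j * y k + ∑ j, ∑ k, m k j * y k * y j = 0 := by
    simp only [← sum_add_distrib]
    exact sum_eq_zero fun j _ => sum_eq_zero fun k _ => by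
      linear_combination (y j * y k) * hm j k
  linarith

open Finset in
/-- A cubic form whose coefficients have vanishing cyclic sums vanishes. -/
theorem sum_mul_mul_mul_eq_zero_of_cyclic {ι : Type*} [Fintype ι] (B : ι → ι → ι → ℝ)
    (hB : ∀ i j k, B j i k + B i k j + B k j i = 0) (y : ι → ℝ) :
    ∑ i, ∑ j, ∑ k, B j i k * (y i * y j * y k) = 0 := by
  have h₁ : ∑ i, ∑ j, ∑ k, B j i k * (y i * y j * y k)
      = ∑ i, ∑ j, ∑ k, B i k j * (y i * y j * y k) := by
    rw [sum_comm]
    refine (sum_congr rfl fun j _ => sum_comm).trans ?_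
    exact sum_congr rfl fun i _ => sum_congr rfl fun j _ => sum_congr rfl fun k _ => by ring
  have h₂ : ∑ i, ∑ j, ∑ k, B j i k * (y i * y j * y k)
      = ∑ i, ∑ j, ∑ k, B k j i * (y i * y j * y k) := by
    refine (sum_congr rfl fun i _ => sum_comm).trans ?_
    rw [sum_comm]
    exact sum_congr rfl fun i _ => sum_congr rfl fun j _ => sum_congr rfl fun k _ => by ring
  have hsum : ∑ i, ∑ j, ∑ k, B j i k * (y i * y j * y k)
      + ∑ i, ∑ j, ∑ k, B i k j * (y i * y j * y k)
      + ∑ i, ∑ j, ∑ k, B k j i * (y i * y j * y k) = 0 := by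
    simp only [← sum_add_distrib]
    exact sum_eq_zero fun i _ => sum_eq_zero fun j _ => sum_eq_zero fun k _ => by
      linear_combination (y i * y j * y k) * hB i j k
  linarith

/-- The derivative of a Gaussian profile in one real variable. -/
theorem hasDerivAt_gaussian_profile (C l r x : ℝ) :
    HasDerivAt (fun s => C * Real.exp (-l * (s ^ 2 + r)))
      (-2 * l * x * (C * Real.exp (-l * (x ^ 2 + r)))) x := by
  refine (((((hasDerivAt_pow 2 x).add_const r).const_mul (-l)).exp).const_mul C).congr_deriv ?_
  push_cast
  ring

/-- The partial derivative of a Gaussian profile in the `j`-th coordinate. -/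
theorem hasDerivAt_gaussian_profile_update {ι : Type*} [Fintype ι] [DecidableEq ι]
    (C l r : ℝ) (y : ι → ℝ) (j : ι) :
    HasDerivAt (fun s => C * Real.exp (-l * (r + ∑ i, (Function.update y j s i) ^ 2)))
      (-2 * l * y j * (C * Real.exp (-l * (r + ∑ i, (y i) ^ 2)))) (y j) := by
  have hsum (s : ℝ) : r + ∑ i, (Function.update y j s i) ^ 2
      = s ^ 2 + (r + ∑ i ∈ Finset.univ.erase j, (y i) ^ 2) := by
    rw [← Finset.add_sum_erase _ _ (Finset.mem_univ j), Function.update_self,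
      Finset.sum_congr rfl fun i hi => by
        rw [Function.update_of_ne (Finset.ne_of_mem_erase hi)]]
    ring
  have hy : r + ∑ i, (y i) ^ 2 = (y j) ^ 2 + (r + ∑ i ∈ Finset.univ.erase j, (y i) ^ 2) := by
    simpa using hsum (y j)
  simp only [hsum, hy]
  exact hasDerivAt_gaussian_profile C l _ (y j)

/-- The product of Gaussian densities
`ρ(x,y) = (√(2γ)/(√(2π)σ))^{n+1} exp(−(γ/σ²)(x² + ∑_j y_j²))`
is a stationary solution of the Fokker–Planck equation of the full triad model. -/
theorem triad_stationary_FokkerPlanck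
    (n : ℕ) (hn : 1 ≤ n)
    (γ σ ε : ℝ) (hγ : 0 < γ) (hσ : 0 < σ) (hε : ε ≠ 0)
    (a c : Fin n → Fin n → ℝ)
    (hac : ∀ j k, a j k + a k j + c j k + c k j = 0)
    (ha0 : ∀ j, a j j = 0) (hc0 : ∀ j, c j j = 0)
    (B : Fin n → Fin n → Fin n → ℝ)
    (hB : ∀ i j k, B j i k + B i k j + B k j i = 0)
    (hB0 : ∀ j i k, j = i ∨ j = k ∨ i = k → B j i k = 0)
    (ρ : ℝ → (Fin n → ℝ) → ℝ)
    (hρ : ∀ x y, ρ x y = (Real.sqrt (2 * γ) / (Real.sqrt (2 * Real.pi) * σ)) ^ (n + 1)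
      * Real.exp (-(γ / σ ^ 2) * (x ^ 2 + ∑ j, (y j) ^ 2))) :
    ∀ (x : ℝ) (y : Fin n → ℝ),
      γ * deriv (fun s => s * ρ s y) x
        + σ ^ 2 / 2 * deriv (fun s => deriv (fun u => ρ u y) s) x
        - (1 / ε) * ((∑ j, ∑ k, a j k * y j * y k) * deriv (fun s => ρ s y) x
            + x * ∑ j, ∑ k, c j k *
                deriv (fun s => Function.update y j s k * ρ x (Function.update y j s)) (y j))
        - (1 / ε ^ 2) * ∑ i, ∑ j, ∑ k, B j i k *
            deriv (fun s => Function.update y j s i * Function.update y j s k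
              * ρ x (Function.update y j s)) (y j) = 0 := by
  intro x y
  have hx (s : ℝ) : HasDerivAt (fun u => ρ u y) (-2 * (γ / σ ^ 2) * s * ρ s y) s := by
    simp only [hρ]
    exact hasDerivAt_gaussian_profile _ _ _ s
  have hy (j : Fin n) : HasDerivAt (fun s => ρ x (Function.update y j s))
      (-2 * (γ / σ ^ 2) * y j * ρ x y) (y j) := by
    simp only [hρ]
    exact hasDerivAt_gaussian_profile_update _ _ _ y j
  have hxρ : deriv (fun s => s * ρ s y) x
      = ρ x y + x * (-2 * (γ / σ ^ 2) * x * ρ x y) := by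
    refine ((hasDerivAt_id' x).mul (hx x)).deriv.trans ?_
    rw [one_mul]
  have hxx : deriv (fun s => deriv (fun u => ρ u y) s) x
      = -2 * (γ / σ ^ 2) * (ρ x y + x * (-2 * (γ / σ ^ 2) * x * ρ x y)) := by
    have hd : (fun s => deriv (fun u => ρ u y) s)
        = fun s => -2 * (γ / σ ^ 2) * (s * ρ s y) := by
      funext s
      rw [(hx s).deriv]
      ring
    rw [hd, ← hxρ]
    exact deriv_const_mul _ ((hasDerivAt_id' x).mul (hx x)).differentiableAt
  have hc (j k : Fin n) : c j k *
      deriv (fun s => Function.update y j s k * ρ x (Function.update y j s)) (y j)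
      = -2 * (γ / σ ^ 2) * ρ x y * (c j k * y j * y k) := by
    rcases eq_or_ne k j with rfl | hkj
    · simp [hc0]
    · simp only [Function.update_of_ne hkj]
      rw [((hy j).const_mul (y k)).deriv]
      ring
  have hb (i j k : Fin n) : B j i k *
      deriv (fun s => Function.update y j s i * Function.update y j s k
        * ρ x (Function.update y j s)) (y j)
      = -2 * (γ / σ ^ 2) * ρ x y * (B j i k * (y i * y j * y k)) := by
    by_cases h : j = i ∨ j = k
    · have h0 : B j i k = 0 := hB0 j i k (h.imp_right Or.inl)
      simp [h0]
    · obtain ⟨hji, hjk⟩ := not_or.mp h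
      simp only [Function.update_of_ne (Ne.symm hji), Function.update_of_ne (Ne.symm hjk)]
      rw [((hy j).const_mul (y i * y k)).deriv]
      ring
  have hquad : ∑ j, ∑ k, a j k * y j * y k + ∑ j, ∑ k, c j k * y j * y k = 0 := by
    rw [← sum_mul_mul_eq_zero_of_antisymm (fun j k => a j k + c j k)
      (fun j k => by linear_combination hac j k) y]
    simp only [← Finset.sum_add_distrib, add_mul]
  have hcubic := sum_mul_mul_mul_eq_zero_of_cyclic B hB y
  simp only [hc, hb, ← Finset.mul_sum]
  rw [hxρ, hxx, (hx x).deriv, hcubic]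
  have hγσ : σ ^ 2 * (γ / σ ^ 2) = γ := by field_simp
  linear_combination
    (1 / ε) * (2 * (γ / σ ^ 2) * x * ρ x y) * hquad
      - (ρ x y + x * (-2 * (γ / σ ^ 2) * x * ρ x y)) * hγσ
end
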